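/- Consider the DRB game on the k-dimensional grid with k > 1, starting from the navigable profile r ≡ k. Suppose each node u ∈ V is independently marked as a deviator with probability p_u, where p_u ≤ 1 − n^{−ε} for every u. Then for any constant ε with 0 < ε < γ/4, there exists n0 ∈ ℕ (depending only on k, γ, and ε) such that for all n ≥ n0: with probability at least 1 − 1/n over the random set of deviators, for EVERY assignment of strategies in Σ to the deviating nodes (deviators take arbitrary strategies, non-deviators keep strategy k, yielding a perturbed profile r'), every node u has r_u = k as its unique best response to r'_{−u}; hence one synchronous best-response step returns the profile to r ≡ k. -/

import Mathlib

open Finset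

noncomputable section

namespace DRB

/-- Nodes of the `k`-dimensional grid (torus) with side length `n`. -/
abbrev Node (n k : ℕ) := Fin k → Fin n

/-- Grid (Manhattan) distance on the torus:
`d_M(u,v) = Σ_i min(|u_i - v_i|, n - |u_i - v_i|)`. -/
def dM (n k : ℕ) (u v : Node n k) : ℕ :=
  ∑ i, min ((u i : ℤ) - (v i : ℤ)).natAbs (n - ((u i : ℤ) - (v i : ℤ)).natAbs)

/-- All nodes different from `u`. -/
def others (n k : ℕ) (u : Node n k) : Finset (Node n k) :=
  Finset.univ.filter (fun v => v ≠ u)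

/-- Normalization constant `c(s) = Σ_{v ≠ u} d_M(u,v)^{-s}` for node `u`. -/
def cnorm (n k : ℕ) (u : Node n k) (s : ℝ) : ℝ :=
  ∑ v ∈ others n k u, (dM n k u v : ℝ) ^ (-s)

/-- Long-range link probability `p_u(v, s) = d_M(u,v)^{-s} / c(s)`. -/
def linkProb (n k : ℕ) (u v : Node n k) (s : ℝ) : ℝ :=
  (dM n k u v : ℝ) ^ (-s) / cnorm n k u s

/-- Link distance `D(s) = Σ_{v ≠ u} p_u(v,s) · d_M(u,v)` of node `u`. -/
def linkDist (n k : ℕ) (u : Node n k) (s : ℝ) : ℝ :=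
  ∑ v ∈ others n k u, linkProb n k u v s * (dM n k u v : ℝ)

/-- Reciprocity `P_u(r) = Σ_{v ≠ u} p_u(v, r_u) · p_v(u, r_v)`. -/
def recip (n k : ℕ) (r : Node n k → ℝ) (u : Node n k) : ℝ :=
  ∑ v ∈ others n k u, linkProb n k u v (r u) * linkProb n k v u (r v)

/-- DRB payoff `π_u(r) = D(r_u) · P_u(r)`. -/
def payoff (n k : ℕ) (r : Node n k → ℝ) (u : Node n k) : ℝ :=
  linkDist n k u (r u) * recip n k r u

/-- Membership in the strategy set `Σ = {0, γ, 2γ, 3γ, ...}`. -/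
def InSigma (γ s : ℝ) : Prop := ∃ m : ℕ, s = m * γ

/-- A valid strategy profile (every coordinate lies in `Σ`). -/
def ValidProfile (n k : ℕ) (γ : ℝ) (r : Node n k → ℝ) : Prop :=
  ∀ u, InSigma γ (r u)

/-- Nash equilibrium of the DRB game with strategy set `Σ` of granularity `γ`. -/
def IsNash (n k : ℕ) (γ : ℝ) (r : Node n k → ℝ) : Prop :=
  ∀ u : Node n k, ∀ s : ℝ, InSigma γ s →
    payoff n k r u ≥ payoff n k (Function.update r u s) u

/-- Strict Nash equilibrium. -/
def IsStrictNash (n k : ℕ) (γ : ℝ) (r : Node n k → ℝ) : Prop :=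
  ∀ u : Node n k, ∀ s : ℝ, InSigma γ s → s ≠ r u →
    payoff n k r u > payoff n k (Function.update r u s) u

/-- `t`-strong Nash equilibrium: no coalition of size ≤ `t` has a weakly
improving joint deviation that strictly improves some member. -/
def IsTStrongNash (n k : ℕ) (γ : ℝ) (t : ℕ) (r : Node n k → ℝ) : Prop :=
  ¬ ∃ (C : Finset (Node n k)) (s : Node n k → ℝ),
      C.Nonempty ∧ C.card ≤ t ∧ (∀ u ∈ C, InSigma γ (s u)) ∧
      (∀ u ∈ C,
        payoff n k (fun v => if v ∈ C then s v else r v) u ≥ payoff n k r u) ∧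
      (∃ u ∈ C,
        payoff n k (fun v => if v ∈ C then s v else r v) u > payoff n k r u)

/-- Strong Nash equilibrium: coalitions of any size. -/
def IsStrongNash (n k : ℕ) (γ : ℝ) (r : Node n k → ℝ) : Prop :=
  ¬ ∃ (C : Finset (Node n k)) (s : Node n k → ℝ),
      C.Nonempty ∧ (∀ u ∈ C, InSigma γ (s u)) ∧
      (∀ u ∈ C,
        payoff n k (fun v => if v ∈ C then s v else r v) u ≥ payoff n k r u) ∧
      (∃ u ∈ C,
        payoff n k (fun v => if v ∈ C then s v else r v) u > payoff n k r u)

/-- `b_u(j)`: the number of nodes at grid distance exactly `j` from `u`. -/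
def countAt (n k : ℕ) (u : Node n k) (j : ℕ) : ℕ :=
  (Finset.univ.filter (fun v => v ≠ u ∧ dM n k u v = j)).card

/-- One asynchronous best-response step: a single node switches to a best
response to the current profile, all other strategies unchanged. -/
def BRStep (n k : ℕ) (γ : ℝ) (r r' : Node n k → ℝ) : Prop :=
  ∃ (u : Node n k) (s : ℝ), InSigma γ s ∧
    (∀ t : ℝ, InSigma γ t →
      payoff n k (Function.update r u s) u ≥ payoff n k (Function.update r u t) u) ∧
    r' = Function.update r u s

/-- One synchronous best-response step: every node simultaneously switches
to a best response to the current profile `r`. -/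
def SyncStep (n k : ℕ) (γ : ℝ) (r r' : Node n k → ℝ) : Prop :=
  ∀ u : Node n k, InSigma γ (r' u) ∧
    ∀ t : ℝ, InSigma γ t →
      payoff n k (Function.update r u (r' u)) u ≥
        payoff n k (Function.update r u t) u

end DRB



namespace DRB

/-- circular distance of two coordinates -/
def cd (n : ℕ) (a b : Fin n) : ℕ :=
  min ((a : ℤ) - (b : ℤ)).natAbs (n - ((a : ℤ) - (b : ℤ)).natAbs)

lemma dM_eq (n k : ℕ) (u v : Node n k) : dM n k u v = ∑ i, cd n (u i) (v i) := rfl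

lemma cd_symm (n : ℕ) (a b : Fin n) : cd n a b = cd n b a := by
  unfold cd
  have : ((a : ℤ) - (b : ℤ)).natAbs = ((b : ℤ) - (a : ℤ)).natAbs := by omega
  rw [this]

lemma dM_symm (n k : ℕ) (u v : Node n k) : dM n k u v = dM n k v u := by
  simp only [dM_eq, cd_symm n (u _) (v _)]

lemma cd_le (n : ℕ) (a b : Fin n) : cd n a b ≤ n := by
  unfold cd; omega

lemma dM_le (n k : ℕ) (u v : Node n k) : dM n k u v ≤ k * n := by
  rw [dM_eq]
  calc _ ≤ ∑ i : Fin k, n := Finset.sum_le_sum fun i _ => cd_le n _ _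
    _ = k * n := by simp

lemma coord_le (n k : ℕ) (u v : Node n k) (i : Fin k) : cd n (u i) (v i) ≤ dM n k u v := by
  rw [dM_eq]
  exact Finset.single_le_sum (f := fun i => cd n (u i) (v i)) (fun _ _ => Nat.zero_le _)
    (Finset.mem_univ i)

lemma cd_pos (n : ℕ) (a b : Fin n) (h : a ≠ b) : 1 ≤ cd n a b := by
  have := Fin.val_ne_of_ne h
  unfold cd; omega

lemma dM_pos (n k : ℕ) (u v : Node n k) (h : v ≠ u) : 1 ≤ dM n k u v := by
  obtain ⟨i, hi⟩ := Function.ne_iff.mp h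
  exact (cd_pos n _ _ hi.symm).trans (coord_le n k u v i)

lemma sum_inj_le (n : ℕ) (f : ℕ → ℝ) (hf : ∀ j, 0 ≤ f j) (S : Finset (Fin n)) (φ : Fin n → ℕ)
    (hφ : ∀ b ∈ S, φ b ≤ n) (hi : Set.InjOn φ S) :
    ∑ b ∈ S, f (φ b) ≤ ∑ j ∈ range (n + 1), f j := by
  rw [← Finset.sum_image (f := f) (g := φ) hi]
  apply Finset.sum_le_sum_of_subset_of_nonneg
  · intro j hj
    obtain ⟨b, hb, rfl⟩ := Finset.mem_image.mp hj
    exact Finset.mem_range.mpr (Nat.lt_succ_of_le (hφ b hb))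
  · intros; exact hf _

lemma harm_range (n : ℕ) :
    ∑ j ∈ range (n + 1), (1 / (max 1 j : ℕ) : ℝ) ≤ 2 + Real.log n := by
  rw [Finset.sum_range_succ']
  have h1 : ∑ j ∈ range n, (1 / (max 1 (j + 1) : ℕ) : ℝ) = ((harmonic n : ℚ) : ℝ) := by
    unfold harmonic
    push_cast
    apply Finset.sum_congr rfl
    intro j _
    have : max (1 : ℝ) (j + 1) = j + 1 := max_eq_right (by linarith [Nat.cast_nonneg (α := ℝ) j])
    rw [this, one_div]
  rw [h1]
  have := harmonic_le_one_add_log n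
  norm_num
  linarith

lemma sum_dist_le (n : ℕ) (a : Fin n) :
    ∑ b : Fin n, (1 / (max 1 (cd n a b) : ℕ) : ℝ) ≤ 4 * (2 + Real.log n) := by
  set f : ℕ → ℝ := fun j => 1 / (max 1 j : ℕ) with hfd
  have hf : ∀ j, 0 ≤ f j := fun j => by simp only [hfd]; positivity
  set x : Fin n → ℕ := fun b => ((a : ℤ) - (b : ℤ)).natAbs with hx
  have h0 : ∀ b, f (cd n a b) ≤ f (x b) + f (n - x b) := by
    intro b
    have : cd n a b = x b ∨ cd n a b = n - x b := by
      unfold cd; simp only [hx]; omega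
    rcases this with h | h <;> rw [h] <;> linarith [hf (x b), hf (n - x b)]
  have hxl : ∀ b, x b < n := fun b => by simp only [hx]; omega
  have h1 : ∀ φ : Fin n → ℕ, (∀ b, φ b ≤ n) → (∀ b c, φ b = φ c → x b = x c) →
      ∑ b : Fin n, f (φ b) ≤ 2 * (2 + Real.log n) := by
    intro φ h1 h2
    rw [← Finset.sum_filter_add_sum_filter_not univ (fun b : Fin n => b ≤ a)]
    have e1 := sum_inj_le n f hf (univ.filter (fun b : Fin n => b ≤ a)) φ (fun b _ => h1 b) (by
      intro b hb c hc hbc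
      have := h2 b c hbc
      have hb := (Finset.mem_filter.mp hb).2
      have hc := (Finset.mem_filter.mp hc).2
      rw [Fin.le_def] at hb hc
      simp only [hx] at this
      apply Fin.ext; omega)
    have e2 := sum_inj_le n f hf (univ.filter (fun b : Fin n => ¬ b ≤ a)) φ (fun b _ => h1 b) (by
      intro b hb c hc hbc
      have := h2 b c hbc
      have hb := (Finset.mem_filter.mp hb).2
      have hc := (Finset.mem_filter.mp hc).2
      rw [Fin.le_def] at hb hc
      simp only [hx] at this
      apply Fin.ext; omega)
    have := harm_range n
    linarith
  calc ∑ b : Fin n, f (cd n a b) ≤ ∑ b : Fin n, (f (x b) + f (n - x b)) :=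
        Finset.sum_le_sum fun b _ => h0 b
    _ = ∑ b : Fin n, f (x b) + ∑ b : Fin n, f (n - x b) := Finset.sum_add_distrib
    _ ≤ 2 * (2 + Real.log n) + 2 * (2 + Real.log n) := by
        apply add_le_add
        · exact h1 x (fun b => (hxl b).le) (fun _ _ h => h)
        · refine h1 (fun b => n - x b) (fun b => Nat.sub_le _ _) (fun b c h => ?_)
          have := hxl b; have := hxl c; omega
    _ = _ := by ring

/-- the polylogarithmic bound for the normalization at exponent `k` -/
def CC (n k : ℕ) : ℝ := (4 * (2 + Real.log n)) ^ k

lemma mem_others {n k : ℕ} {u v : Node n k} : v ∈ others n k u ↔ v ≠ u := by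
  simp [others]

lemma dpos {n k : ℕ} {u v : Node n k} (h : v ∈ others n k u) : (1 : ℝ) ≤ dM n k u v := by
  exact_mod_cast dM_pos n k u v (mem_others.mp h)

lemma cnorm_k_le (n k : ℕ) (u : Node n k) : cnorm n k u k ≤ CC n k := by
  unfold cnorm CC
  calc ∑ v ∈ others n k u, (dM n k u v : ℝ) ^ (-(k : ℝ))
      ≤ ∑ v ∈ others n k u, ∏ i, (1 / (max 1 (cd n (u i) (v i)) : ℕ) : ℝ) := by
        apply Finset.sum_le_sum
        intro v hv
        have hd := dpos hv
        rw [Real.rpow_neg (by linarith), Real.rpow_natCast]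
        have : ((dM n k u v : ℝ) ^ k)⁻¹ = ∏ i : Fin k, (1 / (dM n k u v : ℝ)) := by
          simp
        rw [this]
        apply Finset.prod_le_prod
        · intros; positivity
        · intro i _
          apply one_div_le_one_div_of_le
          · exact_mod_cast (Nat.lt_of_lt_of_le Nat.zero_lt_one (le_max_left _ _))
          · exact_mod_cast max_le (dM_pos n k u v (mem_others.mp hv)) (coord_le n k u v i)
    _ ≤ ∑ v : Node n k, ∏ i, (1 / (max 1 (cd n (u i) (v i)) : ℕ) : ℝ) := by
        apply Finset.sum_le_sum_of_subset_of_nonneg (Finset.subset_univ _)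
        intros; positivity
    _ = ∏ i, ∑ b : Fin n, (1 / (max 1 (cd n (u i) b) : ℕ) : ℝ) := by
        rw [Fintype.prod_sum]
    _ ≤ ∏ i : Fin k, (4 * (2 + Real.log n)) := by
        apply Finset.prod_le_prod
        · intros; positivity
        · intro i _; exact sum_dist_le n (u i)
    _ = _ := by simp

lemma card_others (n k : ℕ) (hn : 2 ≤ n) (hk : 1 < k) (u : Node n k) :
    (n : ℝ) ^ k / 2 ≤ ((others n k u).card : ℝ) := by
  have h : (others n k u).card = n ^ k - 1 := by
    have : others n k u = univ.erase u := by ext v; simp [others]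
    rw [this, Finset.card_erase_of_mem (mem_univ _)]
    simp
  have h2 : 2 ≤ n ^ k := hn.trans (Nat.le_self_pow (by omega) n)
  rw [h, Nat.cast_sub (by omega)]
  have : (2 : ℝ) ≤ (n : ℝ) ^ k := by exact_mod_cast h2
  push_cast
  linarith

lemma cnorm_ge (n k : ℕ) (hn : 2 ≤ n) (hk : 1 < k) (u : Node n k) (s : ℝ) (hs : 0 ≤ s) :
    (n : ℝ) ^ k / 2 * ((k : ℝ) * n) ^ (-s) ≤ cnorm n k u s := by
  unfold cnorm
  calc _ ≤ ((others n k u).card : ℝ) * ((k : ℝ) * n) ^ (-s) := by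
        apply mul_le_mul_of_nonneg_right (card_others n k hn hk u); positivity
    _ = ∑ v ∈ others n k u, ((k : ℝ) * n) ^ (-s) := by simp
    _ ≤ _ := by
        apply Finset.sum_le_sum
        intro v hv
        apply Real.rpow_le_rpow_of_nonpos
        · linarith [dpos hv]
        · exact_mod_cast dM_le n k u v
        · linarith

lemma exists_nbr (n k : ℕ) (hn : 2 ≤ n) (hk : 1 < k) (u : Node n k) :
    ∃ v ∈ others n k u, dM n k u v = 1 := by
  have h1 : ∀ a : Fin n, ∃ b : Fin n, cd n a b = 1 := by
    intro a
    by_cases h : (a : ℕ) + 1 < n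
    · refine ⟨⟨a + 1, h⟩, ?_⟩
      unfold cd; push_cast; omega
    · refine ⟨⟨a - 1, by omega⟩, ?_⟩
      unfold cd; simp only; omega
  have h00 : ∀ a : Fin n, cd n a a = 0 := by intro a; unfold cd; simp
  obtain ⟨b, hb⟩ := h1 (u ⟨0, by omega⟩)
  have hd : dM n k u (Function.update u ⟨0, by omega⟩ b) = 1 := by
    rw [dM_eq, Finset.sum_eq_single ⟨0, by omega⟩]
    · simpa using hb
    · intro i _ hi
      rw [Function.update_of_ne hi, h00]
    · simp
  refine ⟨_, mem_others.mpr ?_, hd⟩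
  intro h
  rw [h, dM_eq] at hd
  simp [h00] at hd

lemma cnorm_ge_one (n k : ℕ) (hn : 2 ≤ n) (hk : 1 < k) (u : Node n k) (s : ℝ) :
    1 ≤ cnorm n k u s := by
  obtain ⟨v, hv, h1⟩ := exists_nbr n k hn hk u
  unfold cnorm
  have := Finset.single_le_sum (f := fun v => (dM n k u v : ℝ) ^ (-s))
    (fun _ _ => by positivity) hv
  simpa [h1] using this

lemma linkDist_eq (n k : ℕ) (u : Node n k) (s : ℝ) :
    linkDist n k u s = cnorm n k u (s - 1) / cnorm n k u s := by
  unfold linkDist linkProb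
  conv_rhs => rw [cnorm, Finset.sum_div]
  apply Finset.sum_congr rfl
  intro v hv
  have := dpos hv
  rw [div_mul_eq_mul_div]
  congr 1
  rw [show -(s - 1) = -s + 1 by ring, Real.rpow_add_one (by linarith)]

lemma linkDist_le (n k : ℕ) (hn : 2 ≤ n) (hk : 1 < k) (u : Node n k) (s : ℝ) :
    linkDist n k u s ≤ k * n := by
  have h1 := cnorm_ge_one n k hn hk u s
  unfold linkDist linkProb
  calc _ ≤ ∑ v ∈ others n k u, (dM n k u v : ℝ) ^ (-s) / cnorm n k u s * ((k : ℝ) * n) := by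
        apply Finset.sum_le_sum
        intro v _
        apply mul_le_mul_of_nonneg_left
        · exact_mod_cast dM_le n k u v
        · have : 0 ≤ cnorm n k u s := by linarith
          positivity
    _ = _ := by
        rw [← Finset.sum_mul, ← Finset.sum_div]
        change cnorm n k u s / cnorm n k u s * _ = _
        rw [div_self (by linarith), one_mul]

/-- universal upper bound on incoming link probabilities -/
lemma linkProb_le (n k : ℕ) (hn : 2 ≤ n) (hk : 1 < k) (u v : Node n k) (hv : v ∈ others n k u)
    (s : ℝ) (hs : 0 ≤ s) :
    linkProb n k v u s ≤ 2 * (k : ℝ) ^ k * (dM n k u v : ℝ) ^ (-(k : ℝ)) := by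
  unfold linkProb
  rw [dM_symm n k v u]
  have hd := dpos hv
  set d : ℝ := (dM n k u v : ℝ) with hdd
  have hk1 : (1 : ℝ) ≤ k := by exact_mod_cast hk.le
  have hkk : (1 : ℝ) ≤ (k : ℝ) ^ k := one_le_pow₀ hk1
  rw [div_le_iff₀ (by linarith [cnorm_ge_one n k hn hk v s])]
  rcases le_total (k : ℝ) s with h | h
  · calc d ^ (-s) ≤ d ^ (-(k : ℝ)) := Real.rpow_le_rpow_of_exponent_le hd (by linarith)
      _ = 1 * d ^ (-(k : ℝ)) * 1 := by ring
      _ ≤ _ := by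
        apply mul_le_mul _ (cnorm_ge_one n k hn hk v s) (by norm_num) (by positivity)
        apply mul_le_mul_of_nonneg_right _ (by positivity)
        linarith
  · have hc := cnorm_ge n k hn hk v s hs
    have hn0 : (0 : ℝ) < n := by positivity
    have hkn : (0 : ℝ) < (k : ℝ) * n := by positivity
    have hle : d ≤ (k : ℝ) * n := by rw [hdd]; exact_mod_cast dM_le n k u v
    have hd0 : 0 < d := by linarith
    have h3 : ((k : ℝ) * n / d) ^ s ≤ ((k : ℝ) * n / d) ^ (k : ℝ) :=
      Real.rpow_le_rpow_of_exponent_le ((one_le_div hd0).mpr hle) h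
    rw [Real.div_rpow hkn.le hd0.le, Real.div_rpow hkn.le hd0.le] at h3
    calc d ^ (-s) = (((k : ℝ) * n) ^ s / d ^ s) * ((k : ℝ) * n) ^ (-s) := by
          rw [Real.rpow_neg hd0.le, Real.rpow_neg hkn.le]
          field_simp
      _ ≤ (((k : ℝ) * n) ^ (k : ℝ) / d ^ (k : ℝ)) * ((k : ℝ) * n) ^ (-s) :=
          mul_le_mul_of_nonneg_right h3 (by positivity)
      _ = 2 * (k : ℝ) ^ k * d ^ (-(k : ℝ)) * ((n : ℝ) ^ k / 2 * ((k : ℝ) * n) ^ (-s)) := by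
          rw [Real.rpow_neg hd0.le (k : ℝ), Real.rpow_natCast, Real.rpow_natCast, mul_pow]
          field_simp
      _ ≤ _ := mul_le_mul_of_nonneg_left hc (by positivity)

lemma upper (n k : ℕ) (hn : 2 ≤ n) (hk : 1 < k) (u : Node n k) (γ : ℝ) (hγ0 : 0 < γ)
    (hγ1 : γ ≤ 1) (w : Node n k → ℝ)
    (hw : ∀ v ∈ others n k u, w v ≤ 2 * (k : ℝ) ^ k * (dM n k u v : ℝ) ^ (-(k : ℝ)))
    (s : ℝ) (hs : 0 ≤ s) (h : s ≤ k - γ ∨ k + γ ≤ s) (hw0 : ∀ v ∈ others n k u, 0 ≤ w v) :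
    linkDist n k u s * ∑ v ∈ others n k u, linkProb n k u v s * w v ≤
      4 * (k : ℝ) ^ (2 * k + 1) * CC n k * (n : ℝ) ^ (1 - γ) := by
  have hk1 : (1 : ℝ) ≤ k := by exact_mod_cast hk.le
  have hk0 : (0 : ℝ) < k := by linarith
  have hn1 : (1 : ℝ) ≤ n := by exact_mod_cast (by omega : 1 ≤ n)
  have hn0 : (0 : ℝ) < n := by linarith
  have hkn : (0 : ℝ) < (k : ℝ) * n := by positivity
  have hc1 := cnorm_ge_one n k hn hk u s
  have hc0 : 0 < cnorm n k u s := by linarith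
  have hck := cnorm_k_le n k u
  have hck1 := cnorm_ge_one n k hn hk u k
  have hCC : 1 ≤ CC n k := hck1.trans hck
  have hkk : (1 : ℝ) ≤ (k : ℝ) ^ k := one_le_pow₀ hk1
  have hP0 : 0 ≤ ∑ v ∈ others n k u, linkProb n k u v s * w v := by
    apply Finset.sum_nonneg
    intro v hv
    have := hw0 v hv
    unfold linkProb; positivity
  rcases h with h | h
  · have hP : ∑ v ∈ others n k u, linkProb n k u v s * w v ≤
        4 * (k : ℝ) ^ (2 * k) * CC n k * (n : ℝ) ^ (-γ) := by
      calc _ ≤ ∑ v ∈ others n k u, 1 / cnorm n k u s *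
            (2 * (k : ℝ) ^ k * (dM n k u v : ℝ) ^ (-(k : ℝ))) := by
            apply Finset.sum_le_sum
            intro v hv
            apply mul_le_mul _ (hw v hv) (hw0 v hv) (by positivity)
            unfold linkProb
            apply div_le_div_of_nonneg_right _ hc0.le
            exact Real.rpow_le_one_of_one_le_of_nonpos (dpos hv) (by linarith)
        _ = 1 / cnorm n k u s * (2 * (k : ℝ) ^ k * cnorm n k u k) := by
            rw [← Finset.mul_sum, ← Finset.mul_sum]; rfl
        _ ≤ 2 * (k : ℝ) ^ k * (n : ℝ) ^ (-γ) * (2 * (k : ℝ) ^ k * CC n k) := by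
            apply mul_le_mul _ (by gcongr) (by positivity) (by positivity)
            rw [div_le_iff₀ hc0]
            have hge := cnorm_ge n k hn hk u s hs
            calc (1 : ℝ) ≤ 2 * (k : ℝ) ^ k * (n : ℝ) ^ (-γ) *
                  ((n : ℝ) ^ k / 2 * ((k : ℝ) * n) ^ (-s)) := by
                  have e1 : ((k : ℝ) * n) ^ s ≤ (k : ℝ) ^ k * (n : ℝ) ^ k * (n : ℝ) ^ (-γ) := by
                    rw [Real.mul_rpow hk0.le hn0.le, mul_assoc]
                    apply mul_le_mul _ _ (by positivity) (by positivity)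
                    · rw [← Real.rpow_natCast]
                      exact Real.rpow_le_rpow_of_exponent_le hk1 (by linarith)
                    · rw [← Real.rpow_natCast (n : ℝ) k, ← Real.rpow_add hn0]
                      exact Real.rpow_le_rpow_of_exponent_le hn1 (by linarith)
                  have e2 : 0 < ((k : ℝ) * n) ^ s := by positivity
                  rw [Real.rpow_neg hkn.le]
                  have : 2 * (k : ℝ) ^ k * (n : ℝ) ^ (-γ) *
                    ((n : ℝ) ^ k / 2 * (((k : ℝ) * n) ^ s)⁻¹) =
                    ((k : ℝ) ^ k * (n : ℝ) ^ k * (n : ℝ) ^ (-γ)) / ((k : ℝ) * n) ^ s := by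
                    field_simp
                  rw [this, one_le_div e2]
                  exact e1
              _ ≤ _ := mul_le_mul_of_nonneg_left hge (by positivity)
        _ = _ := by ring
    calc _ ≤ ((k : ℝ) * n) * (4 * (k : ℝ) ^ (2 * k) * CC n k * (n : ℝ) ^ (-γ)) :=
          mul_le_mul (linkDist_le n k hn hk u s) hP hP0 hkn.le
      _ = _ := by
          rw [show (1 - γ) = -γ + 1 by ring, Real.rpow_add_one hn0.ne']
          ring
  · have hP : ∑ v ∈ others n k u, linkProb n k u v s * w v ≤ 2 * (k : ℝ) ^ k := by
      calc _ ≤ ∑ v ∈ others n k u, (dM n k u v : ℝ) ^ (-s) / cnorm n k u s *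
            (2 * (k : ℝ) ^ k) := by
            apply Finset.sum_le_sum
            intro v hv
            apply mul_le_mul (le_of_eq rfl) _ (hw0 v hv) (div_nonneg (by positivity) hc0.le)
            refine (hw v hv).trans ?_
            apply mul_le_of_le_one_right (by positivity)
            exact Real.rpow_le_one_of_one_le_of_nonpos (dpos hv) (by linarith)
        _ = cnorm n k u s / cnorm n k u s * (2 * (k : ℝ) ^ k) := by
            rw [← Finset.sum_mul, ← Finset.sum_div]; rfl
        _ = _ := by rw [div_self hc0.ne', one_mul]
    have hD : linkDist n k u s ≤ CC n k * ((k : ℝ) * (n : ℝ) ^ (1 - γ)) := by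
      rw [linkDist_eq]
      have : cnorm n k u (s - 1) ≤ cnorm n k u k * ((k : ℝ) * n) ^ (1 - γ) := by
        unfold cnorm
        rw [Finset.sum_mul]
        apply Finset.sum_le_sum
        intro v hv
        have hd := dpos hv
        calc (dM n k u v : ℝ) ^ (-(s - 1)) ≤ (dM n k u v : ℝ) ^ (-(k : ℝ) + (1 - γ)) :=
              Real.rpow_le_rpow_of_exponent_le hd (by linarith)
          _ = (dM n k u v : ℝ) ^ (-(k : ℝ)) * (dM n k u v : ℝ) ^ (1 - γ) :=
              Real.rpow_add (by linarith) _ _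
          _ ≤ _ := by
              apply mul_le_mul_of_nonneg_left _ (by positivity)
              apply Real.rpow_le_rpow (by linarith) _ (by linarith)
              exact_mod_cast dM_le n k u v
      calc _ ≤ cnorm n k u (s - 1) :=
            div_le_self (by linarith [cnorm_ge_one n k hn hk u (s - 1)]) hc1
        _ ≤ _ := this
        _ ≤ _ := by
            apply mul_le_mul hck _ (by positivity) (by linarith)
            rw [Real.mul_rpow hk0.le hn0.le]
            apply mul_le_mul_of_nonneg_right _ (by positivity)
            calc (k : ℝ) ^ (1 - γ) ≤ (k : ℝ) ^ (1 : ℝ) :=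
                  Real.rpow_le_rpow_of_exponent_le hk1 (by linarith)
              _ = k := Real.rpow_one _
    calc _ ≤ CC n k * ((k : ℝ) * (n : ℝ) ^ (1 - γ)) * (2 * (k : ℝ) ^ k) := by
          apply mul_le_mul hD hP hP0 (by positivity)
      _ = (2 * (k : ℝ) ^ (k + 1)) * (CC n k * (n : ℝ) ^ (1 - γ)) := by ring
      _ ≤ (4 * (k : ℝ) ^ (2 * k + 1)) * (CC n k * (n : ℝ) ^ (1 - γ)) := by
          apply mul_le_mul_of_nonneg_right _ (by positivity)
          apply mul_le_mul (by norm_num) _ (by positivity) (by norm_num)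
          exact pow_le_pow_right₀ hk1 (by omega)
      _ = _ := by ring

lemma lower (n k : ℕ) (hn : 2 ≤ n) (hk : 1 < k) (u : Node n k) (R : ℝ) (w : Node n k → ℝ)
    (hw0 : ∀ v ∈ others n k u, 0 ≤ w v) (v : Node n k) (hv : v ∈ others n k u)
    (hR : (dM n k u v : ℝ) ≤ R) (hwv : w v = linkProb n k v u k) :
    (n : ℝ) / (2 * (k : ℝ) ^ k) / (R ^ (2 * k) * CC n k ^ 3) ≤
      linkDist n k u k * ∑ v ∈ others n k u, linkProb n k u v k * w v := by
  have hk1 : (1 : ℝ) ≤ k := by exact_mod_cast hk.le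
  have hk0 : (0 : ℝ) < k := by linarith
  have hn0 : (0 : ℝ) < n := by exact_mod_cast (by omega : 0 < n)
  have hkn : (0 : ℝ) < (k : ℝ) * n := by positivity
  have hd := dpos hv
  have hCC : 1 ≤ CC n k := (cnorm_ge_one n k hn hk u k).trans (cnorm_k_le n k u)
  have hlp : ∀ x y : Node n k, 0 ≤ linkProb n k x y k := by
    intro x y
    have := cnorm_ge_one n k hn hk x k
    unfold linkProb; positivity
  have hR0 : 0 < R := by linarith
  have key : ∀ x y : Node n k, dM n k x y = dM n k u v →
      1 / (R ^ k * CC n k) ≤ linkProb n k x y k := by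
    intro x y hxy
    have := cnorm_ge_one n k hn hk x k
    unfold linkProb
    rw [hxy, Real.rpow_neg (by linarith), Real.rpow_natCast, ← one_div, div_div]
    apply one_div_le_one_div_of_le (by positivity)
    apply mul_le_mul _ (cnorm_k_le n k x) (by positivity) (by positivity)
    exact pow_le_pow_left₀ (by linarith) hR k
  have hP : 1 / (R ^ k * CC n k) * (1 / (R ^ k * CC n k)) ≤
      ∑ v ∈ others n k u, linkProb n k u v k * w v := by
    calc _ ≤ linkProb n k u v k * w v := by
          rw [hwv]
          exact mul_le_mul (key u v rfl) (key v u (dM_symm n k v u)) (by positivity) (hlp _ _)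
      _ ≤ _ := Finset.single_le_sum (f := fun v => linkProb n k u v k * w v)
            (fun v hv => mul_nonneg (hlp _ _) (hw0 v hv)) hv
  have hD : (n : ℝ) / (2 * (k : ℝ) ^ k) / CC n k ≤ linkDist n k u k := by
    rw [linkDist_eq]
    have h1 := cnorm_ge_one n k hn hk u k
    apply div_le_div₀ (by linarith [cnorm_ge_one n k hn hk u (k - 1)]) _ (by linarith)
      (cnorm_k_le n k u)
    refine le_trans ?_ (cnorm_ge n k hn hk u (k - 1) (by linarith))
    rw [show -((k : ℝ) - 1) = -(k : ℝ) + 1 by ring, Real.rpow_add_one hkn.ne',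
      Real.rpow_neg hkn.le, Real.rpow_natCast, mul_pow]
    have : (n : ℝ) ^ k / 2 * (((k : ℝ) ^ k * (n : ℝ) ^ k)⁻¹ * (k * n)) =
      k * (n / (2 * (k : ℝ) ^ k)) := by
      field_simp
    rw [this]
    exact le_mul_of_one_le_left (by positivity) hk1
  calc _ = (n : ℝ) / (2 * (k : ℝ) ^ k) / CC n k *
        (1 / (R ^ k * CC n k) * (1 / (R ^ k * CC n k))) := by
        field_simp
        ring
    _ ≤ _ := mul_le_mul hD hP (by positivity) ((by positivity : (0 : ℝ) ≤ _).trans hD)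

end DRB
namespace DRB

/-- punctured neighbourhood of `u` -/
def nbhd (n k l : ℕ) (u : Node n k) : Finset (Node n k) :=
  (others n k u).filter (fun v => dM n k u v ≤ k * l)

lemma seg_card (n l : ℕ) (hl : 2 * l ≤ n) (a : Fin n) :
    l + 1 ≤ (univ.filter (fun b : Fin n => cd n a b ≤ l)).card := by
  have ha := a.2
  by_cases h : (a : ℕ) + l < n
  · rw [← Finset.card_range (l + 1)]
    apply Finset.card_le_card_of_injOn (fun j => (⟨(a + j) % n, Nat.mod_lt _ (by omega)⟩ : Fin n))
    · intro j hj
      have hj : j < l + 1 := by simpa using hj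
      have e : ((a : ℕ) + j) % n = a + j := Nat.mod_eq_of_lt (by omega)
      refine Finset.mem_coe.mpr (Finset.mem_filter.mpr ⟨Finset.mem_univ _, ?_⟩)
      simp only [cd, e]
      omega
    · intro i hi j hj hij
      have hi : i < l + 1 := by simpa using hi
      have hj : j < l + 1 := by simpa using hj
      have := congrArg Fin.val hij
      simp only at this
      rw [Nat.mod_eq_of_lt (by omega), Nat.mod_eq_of_lt (by omega)] at this
      omega
  · rw [← Finset.card_range (l + 1)]
    apply Finset.card_le_card_of_injOn (fun j => (⟨a - j, by omega⟩ : Fin n))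
    · intro j hj
      have hj : j < l + 1 := by simpa using hj
      refine Finset.mem_coe.mpr (Finset.mem_filter.mpr ⟨Finset.mem_univ _, ?_⟩)
      simp only [cd]
      omega
    · intro i hi j hj hij
      have hi : i < l + 1 := by simpa using hi
      have hj : j < l + 1 := by simpa using hj
      have := congrArg Fin.val hij
      simp only at this
      omega

lemma nbhd_card (n k l : ℕ) (hk : 1 < k) (hl : 2 * l ≤ n) (u : Node n k) :
    l ^ k ≤ (nbhd n k l u).card := by
  have hsub : (Fintype.piFinset (fun i => univ.filter (fun b : Fin n => cd n (u i) b ≤ l))).erase u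
      ⊆ nbhd n k l u := by
    intro v hv
    rw [Finset.mem_erase, Fintype.mem_piFinset] at hv
    refine Finset.mem_filter.mpr ⟨mem_others.mpr hv.1, ?_⟩
    rw [dM_eq]
    calc _ ≤ ∑ i : Fin k, l := Finset.sum_le_sum fun i _ => (Finset.mem_filter.mp (hv.2 i)).2
      _ = _ := by simp
  have h1 := Finset.card_le_card hsub
  have h2 := Finset.pred_card_le_card_erase (a := u)
    (s := Fintype.piFinset (fun i => univ.filter (fun b : Fin n => cd n (u i) b ≤ l)))
  have h3 : (l + 1) ^ k ≤
      (Fintype.piFinset (fun i => univ.filter (fun b : Fin n => cd n (u i) b ≤ l))).card := by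
    rw [Fintype.card_piFinset]
    calc (l + 1) ^ k = ∏ i : Fin k, (l + 1) := by simp
      _ ≤ _ := Finset.prod_le_prod' fun i _ => seg_card n l hl (u i)
  have h4 : l ^ k < (l + 1) ^ k := Nat.pow_lt_pow_left (by omega) (by omega)
  omega

lemma prob_superset {V : Type*} [Fintype V] [DecidableEq V] (p : V → ℝ) (B : Finset V) :
    ∑ A : Finset V, (if B ⊆ A then (∏ u ∈ A, p u) * ∏ u ∈ Aᶜ, (1 - p u) else 0) =
      ∏ u ∈ B, p u := by
  have h := Fintype.prod_add p (fun v => if v ∈ B then 0 else 1 - p v)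
  have h1 : ∏ a, (p a + if a ∈ B then 0 else 1 - p a) = ∏ u ∈ B, p u := by
    rw [← Finset.prod_subset (Finset.subset_univ B)]
    · exact Finset.prod_congr rfl fun v hv => by simp [hv]
    · intro v _ hv; simp [hv]
  rw [← h1, h]
  apply Finset.sum_congr rfl
  intro A _
  split_ifs with hBA
  · congr 1
    apply Finset.prod_congr rfl
    intro v hv
    rw [if_neg]
    intro hvB
    exact (Finset.mem_compl.mp hv) (hBA hvB)
  · obtain ⟨v, hv, hvA⟩ := Finset.not_subset.mp hBA
    rw [Finset.prod_eq_zero (i := v) (Finset.mem_compl.mpr hvA) (by simp [hv]), mul_zero]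

lemma prob_bound {V : Type*} [Fintype V] [DecidableEq V] (p : V → ℝ)
    (h0 : ∀ u, 0 ≤ p u) (h1 : ∀ u, p u ≤ 1) (B : V → Finset V) (δ : ℝ)
    (hB : ∀ u, ∏ v ∈ B u, p v ≤ δ) (Q : Finset V → Prop) [DecidablePred Q]
    (hQ : ∀ A, (∀ u, ¬ B u ⊆ A) → Q A) :
    1 - Fintype.card V * δ ≤
      ∑ A ∈ univ.filter Q, (∏ u ∈ A, p u) * ∏ u ∈ Aᶜ, (1 - p u) := by
  set W : Finset V → ℝ := fun A => (∏ u ∈ A, p u) * ∏ u ∈ Aᶜ, (1 - p u) with hW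
  have hW0 : ∀ A, 0 ≤ W A := fun A => mul_nonneg (Finset.prod_nonneg fun u _ => h0 u)
    (Finset.prod_nonneg fun u _ => by linarith [h1 u])
  have htot : ∑ A, W A = 1 := by
    have := prob_superset p (∅ : Finset V)
    simpa using this
  have hbad : ∑ A ∈ univ.filter (fun A => ¬ Q A), W A ≤ Fintype.card V * δ := by
    calc _ ≤ ∑ A ∈ univ.filter (fun A => ¬ Q A), ∑ u, (if B u ⊆ A then W A else 0) := by
          apply Finset.sum_le_sum
          intro A hA
          have hA := (Finset.mem_filter.mp hA).2
          have : ∃ u, B u ⊆ A := by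
            by_contra hc
            push Not at hc
            exact hA (hQ A hc)
          obtain ⟨u, hu⟩ := this
          have := Finset.single_le_sum (f := fun u => if B u ⊆ A then W A else 0)
            (fun u _ => by split_ifs <;> simp [hW0]) (Finset.mem_univ u)
          simpa [hu] using this
      _ ≤ ∑ A, ∑ u, (if B u ⊆ A then W A else 0) := by
          apply Finset.sum_le_sum_of_subset_of_nonneg (Finset.subset_univ _)
          intro A _ _
          exact Finset.sum_nonneg fun u _ => by split_ifs <;> simp [hW0]
      _ = ∑ u, ∏ v ∈ B u, p v := by
          rw [Finset.sum_comm]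
          exact Finset.sum_congr rfl fun u _ => prob_superset p (B u)
      _ ≤ ∑ u : V, δ := Finset.sum_le_sum fun u _ => hB u
      _ = _ := by simp
  have := Finset.sum_filter_add_sum_filter_not univ Q W
  change _ ≤ ∑ A ∈ univ.filter Q, W A
  linarith

open Filter in
lemma asym (k : ℕ) (hk : 1 < k) (γ ε M : ℝ) (hγ0 : 0 < γ) (hγ1 : γ ≤ 1) (hε : ε < γ / 4) :
    ∃ n0 : ℕ, ∀ n : ℕ, n0 ≤ n → 2 ≤ n ∧ 4 * (n : ℝ) ^ (γ / (4 * k)) ≤ n ∧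
      (k + 1) * Real.log n ≤ (n : ℝ) ^ (γ / 4 - ε) ∧
      4 * (2 + Real.log n) ≤ (n : ℝ) ^ (γ / (16 * k)) ∧ M < (n : ℝ) ^ (γ / 4) := by
  rw [← Filter.eventually_atTop]
  have hc : Tendsto (fun n : ℕ => (n : ℝ)) atTop atTop := tendsto_natCast_atTop_atTop
  have hk1 : (1 : ℝ) < k := by exact_mod_cast hk
  have hlog : ∀ δ : ℝ, 0 < δ → ∀ c : ℝ, 0 < c →
      ∀ᶠ n : ℕ in atTop, Real.log n ≤ c * (n : ℝ) ^ δ := by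
    intro δ hδ c hcp
    have := hc.eventually ((isLittleO_log_rpow_atTop hδ).bound hcp)
    filter_upwards [this] with n hn
    refine (le_abs_self _).trans (hn.trans (le_of_eq ?_))
    rw [Real.norm_of_nonneg (by positivity)]
  have hpow : ∀ δ : ℝ, 0 < δ → ∀ K : ℝ, ∀ᶠ n : ℕ in atTop, K < (n : ℝ) ^ δ := by
    intro δ hδ K
    exact ((tendsto_rpow_atTop hδ).comp hc).eventually_gt_atTop K
  have hθ : γ / (4 * k) < 1 := by
    rw [div_lt_one (by positivity)]; linarith
  have hδ : 0 < γ / (16 * k) := by positivity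
  filter_upwards [eventually_ge_atTop 2, hpow (1 - γ / (4 * k)) (by linarith) 4,
    hlog (γ / 4 - ε) (by linarith) (1 / (k + 1)) (by positivity),
    hlog _ hδ (1 / 8) (by norm_num), hpow _ hδ 16, hpow (γ / 4) (by linarith) M]
    with n h1 h2 h3 h4 h5 h6
  have hn0 : (0 : ℝ) < n := by exact_mod_cast (by omega : 0 < n)
  refine ⟨h1, ?_, ?_, by linarith, h6⟩
  · calc 4 * (n : ℝ) ^ (γ / (4 * k)) ≤ (n : ℝ) ^ (1 - γ / (4 * k)) * (n : ℝ) ^ (γ / (4 * k)) :=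
          mul_le_mul_of_nonneg_right h2.le (by positivity)
      _ = n := by rw [← Real.rpow_add hn0]; simp
  · have : (k + 1 : ℝ) * Real.log n ≤ (k + 1) * (1 / (k + 1) * (n : ℝ) ^ (γ / 4 - ε)) :=
      mul_le_mul_of_nonneg_left h3 (by positivity)
    rwa [← mul_assoc, mul_one_div_cancel (by positivity), one_mul] at this

/-- final numerical comparison -/
lemma compare (n k : ℕ) (hn : 2 ≤ n) (hk : 1 < k) (γ : ℝ)
    (h1 : 4 * (2 + Real.log n) ≤ (n : ℝ) ^ (γ / (16 * k)))
    (h2 : 4 * (k : ℝ) ^ (2 * k + 1) * (2 * (k : ℝ) ^ k) * (2 * (k : ℝ)) ^ (2 * k)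
      < (n : ℝ) ^ (γ / 4)) :
    4 * (k : ℝ) ^ (2 * k + 1) * CC n k * (n : ℝ) ^ (1 - γ) <
      (n : ℝ) / (2 * (k : ℝ) ^ k) /
        ((k * (2 * (n : ℝ) ^ (γ / (4 * k)))) ^ (2 * k) * CC n k ^ 3) := by
  have hk0 : (0 : ℝ) < k := by exact_mod_cast (by omega : 0 < k)
  have hn0 : (0 : ℝ) < n := by exact_mod_cast (by omega : 0 < n)
  have hlog : 0 ≤ Real.log n := Real.log_natCast_nonneg n
  have hCC : 0 < CC n k := by unfold CC; positivity
  have hC4 : CC n k ^ 4 ≤ (n : ℝ) ^ (γ / 4) := by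
    unfold CC
    rw [← pow_mul]
    calc _ ≤ ((n : ℝ) ^ (γ / (16 * k))) ^ (k * 4) := pow_le_pow_left₀ (by positivity) h1 _
      _ = _ := by
        rw [← Real.rpow_natCast, ← Real.rpow_mul hn0.le]
        congr 1
        push_cast
        field_simp
        norm_num
  have hR : (k * (2 * (n : ℝ) ^ (γ / (4 * k)))) ^ (2 * k) =
      (2 * (k : ℝ)) ^ (2 * k) * (n : ℝ) ^ (γ / 2) := by
    rw [show (k * (2 * (n : ℝ) ^ (γ / (4 * k)))) = (2 * (k : ℝ)) * (n : ℝ) ^ (γ / (4 * k)) by ring,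
      mul_pow]
    congr 1
    rw [← Real.rpow_natCast, ← Real.rpow_mul hn0.le]
    congr 1
    push_cast
    field_simp
    norm_num
  rw [hR, div_div, lt_div_iff₀ (by positivity)]
  calc _ = (4 * (k : ℝ) ^ (2 * k + 1) * (2 * (k : ℝ) ^ k) * (2 * (k : ℝ)) ^ (2 * k)) *
        CC n k ^ 4 * ((n : ℝ) ^ (1 - γ) * (n : ℝ) ^ (γ / 2)) := by ring
    _ < (n : ℝ) ^ (γ / 4) * (n : ℝ) ^ (γ / 4) * ((n : ℝ) ^ (1 - γ) * (n : ℝ) ^ (γ / 2)) := by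
        apply mul_lt_mul_of_pos_right _ (by positivity)
        exact mul_lt_mul h2 hC4 (by positivity) (by positivity)
    _ = n := by
        rw [← Real.rpow_add hn0, ← Real.rpow_add hn0, ← Real.rpow_add hn0]
        conv_rhs => rw [← Real.rpow_one (n : ℝ)]
        congr 1
        ring

lemma payoff_update (n k : ℕ) (r : Node n k → ℝ) (u : Node n k) (s : ℝ) :
    payoff n k (Function.update r u s) u =
      linkDist n k u s * ∑ v ∈ others n k u, linkProb n k u v s * linkProb n k v u (r v) := by
  unfold payoff recip
  rw [Function.update_self]
  congr 1
  apply Finset.sum_congr rfl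
  intro v hv
  rw [Function.update_of_ne (mem_others.mp hv)]

lemma sigma_gap (g k : ℕ) (hg : 2 ≤ g) (s : ℝ) (hs : InSigma (g : ℝ)⁻¹ s) (hsk : s ≠ k) :
    0 ≤ s ∧ (s ≤ k - (g : ℝ)⁻¹ ∨ k + (g : ℝ)⁻¹ ≤ s) := by
  obtain ⟨m, rfl⟩ := hs
  have hg0 : (0 : ℝ) < g := by exact_mod_cast (by omega : 0 < g)
  refine ⟨by positivity, ?_⟩
  have hkg : (k : ℝ) = (k * g : ℕ) * (g : ℝ)⁻¹ := by push_cast; field_simp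
  have hne : m ≠ k * g := by rintro rfl; exact hsk hkg.symm
  have hi : 0 ≤ (g : ℝ)⁻¹ := by positivity
  rcases lt_or_gt_of_ne hne with h | h
  · left
    have : (m : ℝ) + 1 ≤ (k * g : ℕ) := by exact_mod_cast h
    rw [hkg]
    nlinarith
  · right
    have : ((k * g : ℕ) : ℝ) + 1 ≤ m := by exact_mod_cast h
    rw [hkg]
    nlinarith

end DRB

open Classical in
/-- Perturbation stability of the navigable equilibrium (`k > 1`).
If each node `u` independently deviates with probability `p_u ≤ 1 - n^{-ε}`
(where `0 < ε < γ/4`), then for all large `n`, with probability at least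
`1 - 1/n` over the random deviator set `A`, for every assignment of `Σ`-strategies
to the deviators (non-deviators keeping strategy `k`, giving the perturbed
profile `r'`), every node has `k` as its unique best response to `r'_{-u}`. -/
theorem navigable_perturbation_stable (k g : ℕ) (hk : 1 < k) (hg : 2 ≤ g)
    (ε : ℝ) (hε0 : 0 < ε) (hε : ε < (g : ℝ)⁻¹ / 4) :
    ∃ n0 : ℕ, ∀ n : ℕ, n0 ≤ n →
      ∀ p : DRB.Node n k → ℝ,
        (∀ u : DRB.Node n k, 0 ≤ p u ∧ p u ≤ 1 - (n : ℝ) ^ (-ε)) →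
        1 - 1 / (n : ℝ) ≤
          ∑ A ∈ Finset.univ.filter (fun A : Finset (DRB.Node n k) =>
              ∀ r' : DRB.Node n k → ℝ,
                DRB.ValidProfile n k (g : ℝ)⁻¹ r' →
                (∀ u : DRB.Node n k, u ∉ A → r' u = (k : ℝ)) →
                ∀ u : DRB.Node n k, ∀ s : ℝ, DRB.InSigma (g : ℝ)⁻¹ s → s ≠ (k : ℝ) →
                  DRB.payoff n k (Function.update r' u (k : ℝ)) u >
                    DRB.payoff n k (Function.update r' u s) u),
            (∏ u ∈ A, p u) * ∏ u ∈ Aᶜ, (1 - p u) := by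
  have hg2 : (2 : ℝ) ≤ g := by exact_mod_cast hg
  have hγ0 : 0 < (g : ℝ)⁻¹ := by positivity
  have hγ1 : (g : ℝ)⁻¹ ≤ 1 := inv_le_one_of_one_le₀ (by linarith)
  obtain ⟨n0, hn0⟩ := DRB.asym k hk (g : ℝ)⁻¹ ε
    (4 * (k : ℝ) ^ (2 * k + 1) * (2 * (k : ℝ) ^ k) * (2 * (k : ℝ)) ^ (2 * k)) hγ0 hγ1 hε
  refine ⟨n0, fun n hn p hp => ?_⟩
  obtain ⟨h2n, h4, hlog, hC, hM⟩ := hn0 n hn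
  clear hn0
  have hk0 : (0 : ℝ) < k := by exact_mod_cast (by omega : 0 < k)
  have hnpos : (0 : ℝ) < n := by exact_mod_cast (by omega : 0 < n)
  have hn1 : (1 : ℝ) ≤ n := by exact_mod_cast (by omega : 1 ≤ n)
  have hθ1 : 1 ≤ (n : ℝ) ^ ((g : ℝ)⁻¹ / (4 * k)) := Real.one_le_rpow hn1 (by positivity)
  set l : ℕ := ⌈(n : ℝ) ^ ((g : ℝ)⁻¹ / (4 * k))⌉₊ with hl
  have hl1 : (n : ℝ) ^ ((g : ℝ)⁻¹ / (4 * k)) ≤ l := Nat.le_ceil _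
  have hl2 : (l : ℝ) ≤ 2 * (n : ℝ) ^ ((g : ℝ)⁻¹ / (4 * k)) := by
    have := Nat.ceil_lt_add_one (a := (n : ℝ) ^ ((g : ℝ)⁻¹ / (4 * k))) (by linarith)
    linarith
  have hln : 2 * l ≤ n := by
    have : (2 : ℝ) * l ≤ n := by linarith
    exact_mod_cast this
  have hnε : 0 < (n : ℝ) ^ (-ε) := by positivity
  have hδ : ∀ u, ∏ v ∈ DRB.nbhd n k l u, p v ≤ ((n : ℝ) ^ (k + 1))⁻¹ := by
    intro u
    have hcard : (n : ℝ) ^ ((g : ℝ)⁻¹ / 4) ≤ ((DRB.nbhd n k l u).card : ℝ) := by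
      calc (n : ℝ) ^ ((g : ℝ)⁻¹ / 4) = ((n : ℝ) ^ ((g : ℝ)⁻¹ / (4 * k))) ^ k := by
            rw [← Real.rpow_natCast, ← Real.rpow_mul hnpos.le]
            congr 1
            field_simp
        _ ≤ (l : ℝ) ^ k := pow_le_pow_left₀ (by positivity) hl1 k
        _ ≤ _ := by exact_mod_cast DRB.nbhd_card n k l hk hln u
    calc ∏ v ∈ DRB.nbhd n k l u, p v ≤ ∏ v ∈ DRB.nbhd n k l u, Real.exp (-(n : ℝ) ^ (-ε)) := by
          apply Finset.prod_le_prod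
          · intro v _; exact (hp v).1
          · intro v _; exact (hp v).2.trans (Real.one_sub_le_exp_neg _)
      _ = Real.exp (-(((DRB.nbhd n k l u).card : ℝ) * (n : ℝ) ^ (-ε))) := by
          rw [Finset.prod_const, ← Real.exp_nat_mul]
          congr 1
          ring
      _ ≤ Real.exp (-((k + 1) * Real.log n)) := by
          apply Real.exp_le_exp.mpr
          apply neg_le_neg
          refine hlog.trans ?_
          rw [sub_eq_add_neg, Real.rpow_add hnpos]
          exact mul_le_mul_of_nonneg_right hcard hnε.le
      _ = _ := by
          rw [Real.exp_neg]
          congr 1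
          rw [show ((k : ℝ) + 1) = ((k + 1 : ℕ) : ℝ) by push_cast; ring, Real.exp_nat_mul,
            Real.exp_log hnpos]
  have hcardV : 1 - 1 / (n : ℝ) = 1 - Fintype.card (DRB.Node n k) * ((n : ℝ) ^ (k + 1))⁻¹ := by
    have : (Fintype.card (DRB.Node n k) : ℝ) = (n : ℝ) ^ k := by simp [DRB.Node]
    rw [this, pow_succ]
    field_simp
  rw [hcardV]
  apply DRB.prob_bound p (fun u => (hp u).1) (fun u => by linarith [(hp u).2])
    (fun u => DRB.nbhd n k l u) _ hδ
  intro A hA r' hval hr' u s hs hsk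
  obtain ⟨v, hv, hvA⟩ := Finset.not_subset.mp (hA u)
  obtain ⟨hvo, hvd⟩ := Finset.mem_filter.mp hv
  obtain ⟨hs0, hgap⟩ := DRB.sigma_gap g k hg s hs hsk
  have hr0 : ∀ v, 0 ≤ r' v := by
    intro v
    obtain ⟨m, hm⟩ := hval v
    rw [hm]; positivity
  have hw0 : ∀ v ∈ DRB.others n k u, 0 ≤ DRB.linkProb n k v u (r' v) := by
    intro v _
    have := DRB.cnorm_ge_one n k h2n hk v (r' v)
    unfold DRB.linkProb
    positivity
  rw [gt_iff_lt, DRB.payoff_update, DRB.payoff_update]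
  have hup := DRB.upper n k h2n hk u (g : ℝ)⁻¹ hγ0 hγ1 (fun v => DRB.linkProb n k v u (r' v))
    (fun v hv => DRB.linkProb_le n k h2n hk u v hv _ (hr0 v)) s hs0 hgap hw0
  have hR : (DRB.dM n k u v : ℝ) ≤ k * (2 * (n : ℝ) ^ ((g : ℝ)⁻¹ / (4 * k))) := by
    calc (DRB.dM n k u v : ℝ) ≤ k * l := by exact_mod_cast hvd
      _ ≤ _ := mul_le_mul_of_nonneg_left hl2 hk0.le
  have hlow := DRB.lower n k h2n hk u _ (fun v => DRB.linkProb n k v u (r' v)) hw0 v hvo hR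
    (by simp only [hr' v hvA])
  exact (hup.trans_lt (DRB.compare n k h2n hk _ hC hM)).trans_le hlow
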